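/- Let M be a locally compact sober MT-algebra. Then M is compact (its top element is compact) if and only if the atom space at(M) is a compact topological space. -/

import Mathlib

/-- An MT-algebra: a complete Boolean algebra with an interior operator. -/
structure MTAlg (M : Type*) [CompleteBooleanAlgebra M] where
  box : M → M
  box_top : box ⊤ = ⊤
  box_inf : ∀ a b : M, box (a ⊓ b) = box a ⊓ box b
  box_le : ∀ a : M, box a ≤ a
  box_idem : ∀ a : M, box a ≤ box (box a)

namespace MTAlg

variable {M : Type*} [CompleteBooleanAlgebra M] (T : MTAlg M)

/-- The closure (dual) operator. -/
def dia (a : M) : M := (T.box aᶜ)ᶜ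

/-- Open elements. -/
def IsOpenElem (a : M) : Prop := T.box a = a

/-- Closed elements. -/
def IsClosedElem (a : M) : Prop := T.dia a = a

/-- Saturated elements: meets of open elements. -/
def IsSaturatedElem (a : M) : Prop :=
  ∃ S : Set M, (∀ s ∈ S, T.IsOpenElem s) ∧ a = sInf S

/-- Weakly locally closed elements: meets of a saturated and a closed element. -/
def IsWLC (a : M) : Prop :=
  ∃ s c : M, T.IsSaturatedElem s ∧ T.IsClosedElem c ∧ a = s ⊓ c

/-- T0-algebras: every element is a join of weakly locally closed elements. -/
def IsT0 : Prop :=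
  ∀ a : M, ∃ S : Set M, (∀ b ∈ S, T.IsWLC b) ∧ a = sSup S

/-- T1-algebras: every element is a join of closed elements. -/
def IsT1 : Prop :=
  ∀ a : M, ∃ S : Set M, (∀ b ∈ S, T.IsClosedElem b) ∧ a = sSup S

/-- Join-irreducible elements of the lattice of closed elements. -/
def JoinIrredClosed (p : M) : Prop :=
  T.IsClosedElem p ∧ p ≠ ⊥ ∧
    ∀ a b : M, T.IsClosedElem a → T.IsClosedElem b → p = a ⊔ b → p = a ∨ p = b

/-- Sober MT-algebras. -/
def Sober : Prop :=
  T.IsT0 ∧ ∀ p : M, T.JoinIrredClosed p → ∃ x : M, IsAtom x ∧ p = T.dia x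

/-- Filters of the underlying lattice. -/
def IsFilter (F : Set M) : Prop :=
  ⊤ ∈ F ∧ (∀ a b : M, a ∈ F → a ≤ b → b ∈ F) ∧ (∀ a b : M, a ∈ F → b ∈ F → a ⊓ b ∈ F)

/-- Open filters. -/
def IsOpenFilter (F : Set M) : Prop :=
  IsFilter F ∧ ∀ a ∈ F, T.box a ∈ F

/-- Scott-open filters. -/
def IsScottOpenFilter (F : Set M) : Prop :=
  T.IsOpenFilter F ∧
    ∀ S : Set M, (∀ s ∈ S, T.IsOpenElem s) → S.Nonempty → DirectedOn (· ≤ ·) S →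
      sSup S ∈ F → ∃ s ∈ S, s ∈ F

/-- Compact elements. -/
def IsCompactElem (a : M) : Prop :=
  ∀ S : Set M, (∀ s ∈ S, T.IsOpenElem s) → a ≤ sSup S →
    ∃ t ⊆ S, t.Finite ∧ a ≤ sSup t

/-- The relation `a ◁ b`: there is a compact element between `a` and `b`. -/
def Triangle (a b : M) : Prop := ∃ k : M, T.IsCompactElem k ∧ a ≤ k ∧ k ≤ b

/-- Locally compact MT-algebras. -/
def LocallyCompact : Prop :=
  ∀ u : M, T.IsOpenElem u → u = sSup {v : M | T.IsOpenElem v ∧ T.Triangle v u}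

/-- The way-below relation in the frame of open elements. -/
def WayBelowOpen (a b : M) : Prop :=
  ∀ S : Set M, (∀ s ∈ S, T.IsOpenElem s) → b ≤ sSup S →
    ∃ t ⊆ S, t.Finite ∧ a ≤ sSup t

/-- Elements approximated from above by regular closed elements. -/
def GC (a : M) : Prop :=
  a = sInf {b : M | ∃ c : M, a ≤ T.box c ∧ b = T.dia (T.box c)}

/-- Hausdorff MT-algebras. -/
def IsHausdorff : Prop :=
  ∀ a : M, ∃ S : Set M, (∀ b ∈ S, T.GC b) ∧ a = sSup S

/-- Regular MT-algebras. -/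
def IsRegular : Prop :=
  T.IsT1 ∧ ∀ a : M, T.IsOpenElem a →
    a = sSup {b : M | T.IsOpenElem b ∧ T.dia b ≤ a}

end MTAlg

/-- The atom space of a complete Boolean algebra. -/
abbrev AtomSpace (M : Type*) [CompleteBooleanAlgebra M] : Type _ := {x : M // IsAtom x}

/-- The set of atoms below an element. -/
def eta {M : Type*} [CompleteBooleanAlgebra M] (a : M) : Set (AtomSpace M) :=
  {x : AtomSpace M | x.1 ≤ a}

namespace MTAlg

variable {M : Type*} [CompleteBooleanAlgebra M] (T : MTAlg M)

/-- The topology on the atom space, generated by the images of open elements. -/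
def atTop : TopologicalSpace (AtomSpace M) :=
  TopologicalSpace.generateFrom {U : Set (AtomSpace M) | ∃ u : M, T.IsOpenElem u ∧ U = eta u}

end MTAlg

namespace MTAlg

variable {M : Type*} [CompleteBooleanAlgebra M] (T : MTAlg M)

theorem box_mono {a b : M} (h : a ≤ b) : T.box a ≤ T.box b := by
  have := T.box_inf a b
  rw [inf_eq_left.2 h] at this
  exact this ▸ inf_le_right

theorem isOpenElem_sSup {S : Set M} (hS : ∀ s ∈ S, T.IsOpenElem s) : T.IsOpenElem (sSup S) :=
  le_antisymm (T.box_le _) <| sSup_le fun s hs ↦ by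
    rw [← hS s hs]
    exact T.box_mono (le_sSup hs)

theorem isClosedElem_compl {a : M} (h : T.IsOpenElem a) : T.IsClosedElem aᶜ := by
  rw [IsClosedElem, dia, compl_compl, h]

theorem isOpenElem_compl {a : M} (h : T.IsClosedElem a) : T.IsOpenElem aᶜ := by
  rw [IsOpenElem, ← compl_inj_iff, compl_compl]
  exact h

theorem le_dia (a : M) : a ≤ T.dia a :=
  le_compl_comm.1 (T.box_le aᶜ)

variable {T}

/-- A compact element below the join of a nonempty chain of open elements lies below a member. -/
theorem IsCompactElem.exists_le_of_isChain {k : M} (hk : T.IsCompactElem k) {C : Set M}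
    (hC : ∀ c ∈ C, T.IsOpenElem c) (hchain : IsChain (· ≤ ·) C) (hne : C.Nonempty)
    (h : k ≤ sSup C) : ∃ c ∈ C, k ≤ c := by
  obtain ⟨t, htC, ht, hkt⟩ := hk C hC h
  obtain rfl | htne := t.eq_empty_or_nonempty
  · obtain ⟨c, hc⟩ := hne
    exact ⟨c, hc, hkt.trans (by simp)⟩
  · obtain ⟨m, hm⟩ := ht.exists_maximal htne
    refine ⟨m, htC hm.prop, hkt.trans (sSup_le fun z hz ↦ ?_)⟩
    exact (hchain.total (htC hz) (htC hm.prop)).elim id (hm.le_of_ge hz)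

/-- An open element maximal among those not above a given element has join-irreducible
complement. -/
theorem joinIrredClosed_compl_of_maximal {k p : M}
    (hp : Maximal (fun u ↦ T.IsOpenElem u ∧ ¬ k ≤ u) p) : T.JoinIrredClosed pᶜ := by
  refine ⟨T.isClosedElem_compl hp.prop.1, fun h ↦ ?_, fun a b ha hb hab ↦ ?_⟩
  · rw [compl_eq_bot] at h
    exact hp.prop.2 (h ▸ le_top)
  · have hpab : p = aᶜ ⊓ bᶜ := by rw [← compl_sup, ← hab, compl_compl]
    have key : ∀ c : M, T.IsClosedElem c → p ≤ cᶜ → ¬ pᶜ = c → k ≤ cᶜ := by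
      intro c hc hpc hne
      by_contra hkc
      exact hne (by rw [hp.eq_of_le ⟨T.isOpenElem_compl hc, hkc⟩ hpc, compl_compl])
    by_contra! hne
    refine hp.prop.2 (hpab ▸ le_inf ?_ ?_)
    · exact key a ha (hpab.trans_le inf_le_left) hne.1
    · exact key b hb (hpab.trans_le inf_le_right) hne.2

/-- In a sober MT-algebra, an open element not above a compact element misses some atom. -/
theorem Sober.exists_atom_not_le (hsob : T.Sober) {k v : M} (hk : T.IsCompactElem k)
    (hv : T.IsOpenElem v) (hkv : ¬ k ≤ v) : ∃ x : M, IsAtom x ∧ ¬ x ≤ v := by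
  obtain ⟨p, hvp, hp⟩ := zorn_le_nonempty₀ {u : M | T.IsOpenElem u ∧ ¬ k ≤ u}
    (fun C hC hchain y hy ↦ ⟨sSup C, ⟨T.isOpenElem_sSup fun c hc ↦ (hC hc).1, fun h ↦ by
      obtain ⟨c, hc, hkc⟩ := hk.exists_le_of_isChain (fun c hc ↦ (hC hc).1) hchain ⟨y, hy⟩ h
      exact (hC hc).2 hkc⟩, fun z hz ↦ le_sSup hz⟩) v ⟨hv, hkv⟩
  obtain ⟨x, hx, hpx⟩ := hsob.2 _ (joinIrredClosed_compl_of_maximal hp)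
  refine ⟨x, hx, fun hxv ↦ hx.1 ?_⟩
  have hxp : x ≤ pᶜ := hpx ▸ T.le_dia x
  exact le_bot_iff.1 ((le_inf (hxv.trans hvp) hxp).trans_eq (inf_compl_self p))

theorem LocallyCompact.eq_top_of_forall_atom_le (hlc : T.LocallyCompact) (hsob : T.Sober) {v : M}
    (hv : T.IsOpenElem v) (h : ∀ x : M, IsAtom x → x ≤ v) : v = ⊤ := by
  refine top_le_iff.1 ((hlc ⊤ T.box_top).trans_le ?_)
  refine sSup_le fun w ⟨_, k, hk, hwk, _⟩ ↦ hwk.trans ?_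
  by_contra hkv
  obtain ⟨x, hx, hxv⟩ := hsob.exists_atom_not_le hk hv hkv
  exact hxv (h x hx)

end MTAlg

theorem IsAtom.exists_le_of_le_sSup {M : Type*} [Order.Frame M] {x : M} (hx : IsAtom x)
    {S : Set M} (h : x ≤ sSup S) : ∃ s ∈ S, x ≤ s := by
  by_contra! hS
  refine hx.1 (disjoint_self.1 (Disjoint.mono_right h ?_))
  exact disjoint_sSup_iff.2 fun s hs ↦ hx.not_le_iff_disjoint.1 (hS s hs)

/-- A locally compact sober MT-algebra is compact iff its atom space is compact. -/
theorem compact_iff_atomSpace_compact {M : Type*} [CompleteBooleanAlgebra M]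
    (T : MTAlg M) (hsob : T.Sober) (hlc : T.LocallyCompact) :
    T.IsCompactElem ⊤ ↔ @CompactSpace (AtomSpace M) T.atTop := by
  let _ : TopologicalSpace (AtomSpace M) := T.atTop
  constructor
  · intro hc
    refine ⟨isCompact_generateFrom rfl fun P hP hcov ↦ ?_⟩
    let S : Set M := {u | T.IsOpenElem u ∧ eta u ∈ P}
    have hS : ∀ s ∈ S, T.IsOpenElem s := fun s hs ↦ hs.1
    have htop : sSup S = ⊤ := by
      refine hlc.eq_top_of_forall_atom_le hsob (T.isOpenElem_sSup hS) fun x hx ↦ ?_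
      obtain ⟨U, hU, hxU⟩ := hcov (Set.mem_univ (⟨x, hx⟩ : AtomSpace M))
      obtain ⟨u, hu, rfl⟩ := hP hU
      exact (show x ≤ u from hxU).trans (le_sSup ⟨hu, hU⟩)
    obtain ⟨t, htS, ht, htt⟩ := hc S hS htop.ge
    refine ⟨eta '' t, Set.image_subset_iff.2 fun u hu ↦ (htS hu).2, ht.image _, fun x _ ↦ ?_⟩
    obtain ⟨u, hu, hxu⟩ := x.2.exists_le_of_le_sSup (le_top.trans htt)
    exact ⟨eta u, Set.mem_image_of_mem _ hu, hxu⟩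
  · intro hc S hS hcov
    obtain ⟨t, htS, ht, htt⟩ := hc.isCompact_univ.elim_finite_subcover_image (b := S) (c := eta)
      (fun u hu ↦ TopologicalSpace.isOpen_generateFrom_of_mem ⟨u, hS u hu, rfl⟩) (fun x _ ↦ by
        obtain ⟨u, hu, hxu⟩ := x.2.exists_le_of_le_sSup (le_top.trans hcov)
        exact Set.mem_biUnion hu hxu)
    refine ⟨t, htS, ht, (hlc.eq_top_of_forall_atom_le hsob
      (T.isOpenElem_sSup fun u hu ↦ hS u (htS hu)) fun x hx ↦ ?_).ge⟩
    obtain ⟨u, hu, hxu⟩ := Set.mem_iUnion₂.1 (htt (Set.mem_univ (⟨x, hx⟩ : AtomSpace M)))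
    exact (show x ≤ u from hxu).trans (le_sSup hu)
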